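/- Let p1,...,p6 be natural numbers with p1 + p6 ≥ max(p2 + p5, p3 + p4). Then Ḡ(p) contains no induced r-cycle for any r ≥ 4 if and only if (p1,...,p6) admits no decomposition. -/

import Mathlib

/-- The four letters labeling vertices. -/
inductive Letter : Type
  | a | b | c | d
deriving DecidableEq

/-- Whether a labeled vertex is in range for the exponent vector `(p1,…,p6)`. -/
def inRange (p1 p2 p3 p4 p5 p6 : ℕ) : Letter × ℕ → Prop
  | (Letter.a, i) => 1 ≤ i ∧ i ≤ max p1 (max p2 p3)
  | (Letter.b, j) => 1 ≤ j ∧ j ≤ max p1 (max p4 p5)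
  | (Letter.c, l) => 1 ≤ l ∧ l ≤ max p2 (max p4 p6)
  | (Letter.d, m) => 1 ≤ m ∧ m ≤ max p3 (max p5 p6)

/-- The vertex set of the graph `G(p)`. -/
def Vertex (p1 p2 p3 p4 p5 p6 : ℕ) : Type :=
  {v : Letter × ℕ // inRange p1 p2 p3 p4 p5 p6 v}

/-- Directed adjacency (one orientation of each cross-letter edge rule). -/
def dirAdj (p1 p2 p3 p4 p5 p6 : ℕ) : Letter × ℕ → Letter × ℕ → Prop
  | (Letter.a, i), (Letter.b, j) => i + j ≤ p1 + 1
  | (Letter.a, i), (Letter.c, l) => i + l ≤ p2 + 1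
  | (Letter.a, i), (Letter.d, m) => i + m ≤ p3 + 1
  | (Letter.b, j), (Letter.c, l) => j + l ≤ p4 + 1
  | (Letter.b, j), (Letter.d, m) => j + m ≤ p5 + 1
  | (Letter.c, l), (Letter.d, m) => l + m ≤ p6 + 1
  | _, _ => False

/-- The graph `G(p)` whose edge ideal is the Alexander dual of the polarization. -/
def tetraGraph (p1 p2 p3 p4 p5 p6 : ℕ) : SimpleGraph (Vertex p1 p2 p3 p4 p5 p6) where
  Adj u v := dirAdj p1 p2 p3 p4 p5 p6 u.val v.val ∨ dirAdj p1 p2 p3 p4 p5 p6 v.val u.val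
  symm := ⟨fun u v h => h.symm⟩
  loopless := by
    constructor
    rintro ⟨⟨L, i⟩, _⟩ h
    cases L <;> simp [dirAdj] at h

/-- An induced `r`-cycle in a graph: `r` distinct vertices, adjacent exactly when
cyclically consecutive. -/
def IsInducedCycle {V : Type*} (H : SimpleGraph V) (r : ℕ) (v : Fin r → V) : Prop :=
  Function.Injective v ∧
    ∀ s t : Fin r, H.Adj (v s) (v t) ↔ ((s.val + 1) % r = t.val ∨ (t.val + 1) % r = s.val)

/-- `(p1,…,p6)` admits a decomposition: there are positive integers `i,j,l,m` with
`i+j = p1+1`, `l+m = p6+1`, `i+l ≥ p2+2`, `i+m ≥ p3+2`, `j+l ≥ p4+2`, `j+m ≥ p5+2`. -/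
def AdmitsDecomposition (p1 p2 p3 p4 p5 p6 : ℕ) : Prop :=
  ∃ i j l m : ℕ, 0 < i ∧ 0 < j ∧ 0 < l ∧ 0 < m ∧
    i + j = p1 + 1 ∧ l + m = p6 + 1 ∧
    p2 + 2 ≤ i + l ∧ p3 + 2 ≤ i + m ∧ p4 + 2 ≤ j + l ∧ p5 + 2 ≤ j + m

instance : Fintype Letter where
  elems := {Letter.a, Letter.b, Letter.c, Letter.d}
  complete := by rintro ⟨⟩ <;> simp

theorem Letter.card : Fintype.card Letter = 4 := rfl

section Adjacency

variable {p1 p2 p3 p4 p5 p6 : ℕ}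

theorem dirAdj_mono_left {L : Letter} {i i' : ℕ} {y : Letter × ℕ} (hi : i ≤ i')
    (hadj : dirAdj p1 p2 p3 p4 p5 p6 (L, i') y) : dirAdj p1 p2 p3 p4 p5 p6 (L, i) y := by
  obtain ⟨M, k⟩ := y
  cases L <;> cases M <;> simp only [dirAdj] at hadj ⊢ <;> omega

theorem dirAdj_mono_right {L : Letter} {i i' : ℕ} {y : Letter × ℕ} (hi : i ≤ i')
    (hadj : dirAdj p1 p2 p3 p4 p5 p6 y (L, i')) : dirAdj p1 p2 p3 p4 p5 p6 y (L, i) := by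
  obtain ⟨M, k⟩ := y
  cases L <;> cases M <;> simp only [dirAdj] at hadj ⊢ <;> omega

theorem tetraGraph_adj_mono {u v w : Vertex p1 p2 p3 p4 p5 p6} (hL : u.val.1 = v.val.1)
    (hi : u.val.2 ≤ v.val.2) (hadj : (tetraGraph p1 p2 p3 p4 p5 p6).Adj v w) :
    (tetraGraph p1 p2 p3 p4 p5 p6).Adj u w := by
  obtain ⟨⟨L, i⟩, hu⟩ := u
  obtain ⟨⟨M, j⟩, hv⟩ := v
  obtain rfl : L = M := hL
  exact hadj.imp (dirAdj_mono_left hi) (dirAdj_mono_right hi)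

theorem tetraGraph_not_adj_of_letter_eq {u v : Vertex p1 p2 p3 p4 p5 p6}
    (hL : u.val.1 = v.val.1) : ¬ (tetraGraph p1 p2 p3 p4 p5 p6).Adj u v := by
  obtain ⟨⟨L, i⟩, hu⟩ := u
  obtain ⟨⟨M, j⟩, hv⟩ := v
  obtain rfl : L = M := hL
  cases L <;> simp [tetraGraph, dirAdj]

end Adjacency

theorem Nat.succ_mod_eq_ite {s r : ℕ} (hs : s < r) :
    (s + 1) % r = if s + 1 = r then 0 else s + 1 := by
  split_ifs with hr
  · simp [hr]
  · exact Nat.mod_eq_of_lt (by omega)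

/-- In an induced cycle of length at least four, no vertex dominates another vertex adjacent
to it. -/
theorem IsInducedCycle.exists_adj_not_adj {V : Type*} {H : SimpleGraph V} {r : ℕ} (hr : 4 ≤ r)
    {v : Fin r → V} (hv : IsInducedCycle H r v) {s t : Fin r} (hst : H.Adj (v s) (v t)) :
    ∃ u : Fin r, u ≠ t ∧ H.Adj (v s) (v u) ∧ ¬ H.Adj (v t) (v u) := by
  have key := hv.2
  simp only [Nat.succ_mod_eq_ite (Fin.is_lt _)] at key
  rw [key] at hst
  have hs := s.is_lt
  have ht := t.is_lt
  obtain ⟨u, hu, hut, hus⟩ : ∃ u, u < r ∧ u ≠ t.val ∧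
      ((if s.val + 1 = r then 0 else s.val + 1) = u ∨
        (if u + 1 = r then 0 else u + 1) = s.val) := by
    rcases hst with hst | hst
    · by_cases h0 : s.val = 0
      · refine ⟨r - 1, ?_⟩
        split_ifs at hst ⊢ <;> omega
      · refine ⟨s.val - 1, ?_⟩
        split_ifs at hst ⊢ <;> omega
    · refine ⟨if s.val + 1 = r then 0 else s.val + 1, ?_⟩
      split_ifs at hst ⊢ <;> omega
  refine ⟨⟨u, hu⟩, fun e => hut (congrArg Fin.val e), (key _ _).2 hus, fun hadj => ?_⟩
  rw [key] at hadj
  dsimp only at hadj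
  split_ifs at hst hus hadj <;> omega

section Cycles

variable {p1 p2 p3 p4 p5 p6 : ℕ}

theorem IsInducedCycle.letter_injective {r : ℕ} (hr : 4 ≤ r)
    {v : Fin r → Vertex p1 p2 p3 p4 p5 p6}
    (hv : IsInducedCycle (tetraGraph p1 p2 p3 p4 p5 p6)ᶜ r v) :
    Function.Injective fun s => (v s).val.1 := by
  intro s t hL
  by_contra hne
  wlog hi : (v s).val.2 ≤ (v t).val.2 generalizing s t
  · exact this hL.symm (Ne.symm hne) (le_of_not_ge hi)
  have hadj : (tetraGraph p1 p2 p3 p4 p5 p6)ᶜ.Adj (v s) (v t) :=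
    (SimpleGraph.compl_adj ..).2 ⟨hv.1.ne hne, tetraGraph_not_adj_of_letter_eq hL⟩
  obtain ⟨u, hut, hsu, htu⟩ := hv.exists_adj_not_adj hr hadj
  refine htu ((SimpleGraph.compl_adj ..).2 ⟨hv.1.ne hut.symm, fun hG => ?_⟩)
  exact ((SimpleGraph.compl_adj ..).1 hsu).2 (tetraGraph_adj_mono hL hi hG)

/-- The three ways of arranging four labels around a 4-cycle, according to which pairs are
opposite. -/
theorem fin_four_cycle_arrangements (C : Fin 4 → Fin 4 → Prop)
    (hC : ∀ s t, C s t ↔ ((s.val + 1) % 4 = t.val ∨ (t.val + 1) % 4 = s.val))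
    {x y z w : Fin 4} (hxy : x ≠ y) (hxz : x ≠ z) (hxw : x ≠ w) (hyz : y ≠ z) (hyw : y ≠ w)
    (hzw : z ≠ w) :
    (¬ C x y ∧ ¬ C z w ∧ C x z ∧ C x w ∧ C y z ∧ C y w) ∨
    (¬ C x z ∧ ¬ C y w ∧ C x y ∧ C z w) ∨
    (¬ C x w ∧ ¬ C y z ∧ C x y ∧ C z w) := by
  simp only [hC]
  revert x y z w
  decide

theorem AdmitsDecomposition.of_isInducedCycle (h : max (p2 + p5) (p3 + p4) ≤ p1 + p6) {r : ℕ}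
    (hr : 4 ≤ r) {v : Fin r → Vertex p1 p2 p3 p4 p5 p6}
    (hv : IsInducedCycle (tetraGraph p1 p2 p3 p4 p5 p6)ᶜ r v) :
    AdmitsDecomposition p1 p2 p3 p4 p5 p6 := by
  have hinj := hv.letter_injective hr
  obtain rfl : r = 4 := by
    have := Fintype.card_le_of_injective _ hinj
    rw [Fintype.card_fin, Letter.card] at this
    omega
  have hsurj := ((Fintype.bijective_iff_injective_and_card _).2
    ⟨hinj, by rw [Fintype.card_fin, Letter.card]⟩).2
  have hadj : ∀ s t, s ≠ t → (((tetraGraph p1 p2 p3 p4 p5 p6)ᶜ.Adj (v s) (v t)) ↔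
      ¬ (dirAdj p1 p2 p3 p4 p5 p6 (v s).val (v t).val ∨
        dirAdj p1 p2 p3 p4 p5 p6 (v t).val (v s).val)) := fun s t hst => by
    rw [SimpleGraph.compl_adj]
    exact and_iff_right (hv.1.ne hst)
  have hex : ∀ L, ∃ s i, (v s).val = (L, i) ∧ 0 < i := fun L => by
    obtain ⟨s, hs⟩ := hsurj L
    rcases hvs : v s with ⟨⟨M, i⟩, hi⟩
    obtain rfl : M = L := by simpa [hvs] using hs
    refine ⟨s, i, by rw [hvs], ?_⟩
    cases M <;> exact hi.1
  obtain ⟨x, i, hx, hi⟩ := hex Letter.a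
  obtain ⟨y, j, hy, hj⟩ := hex Letter.b
  obtain ⟨z, l, hz, hl⟩ := hex Letter.c
  obtain ⟨w, m, hw, hm⟩ := hex Letter.d
  have hne : ∀ {s t : Fin 4} {L M : Letter} {i j : ℕ}, (v s).val = (L, i) →
      (v t).val = (M, j) → L ≠ M → s ≠ t := by
    rintro s t L M i j hs ht hLM rfl
    exact hLM (congrArg Prod.fst (hs.symm.trans ht))
  have hxy : x ≠ y := hne hx hy (by decide)
  have hxz : x ≠ z := hne hx hz (by decide)
  have hxw : x ≠ w := hne hx hw (by decide)
  have hyz : y ≠ z := hne hy hz (by decide)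
  have hyw : y ≠ w := hne hy hw (by decide)
  have hzw : z ≠ w := hne hz hw (by decide)
  have arr := fin_four_cycle_arrangements _ hv.2 hxy hxz hxw hyz hyw hzw
  simp only [hadj _ _ hxy, hadj _ _ hxz, hadj _ _ hxw, hadj _ _ hyz, hadj _ _ hyw,
    hadj _ _ hzw, hx, hy, hz, hw, dirAdj, or_false, not_le, not_lt] at arr
  exact ⟨p1 + 1 - j, j, p6 + 1 - m, m, by omega⟩

theorem AdmitsDecomposition.exists_isInducedCycle
    (hd : AdmitsDecomposition p1 p2 p3 p4 p5 p6) :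
    ∃ v : Fin 4 → Vertex p1 p2 p3 p4 p5 p6,
      IsInducedCycle (tetraGraph p1 p2 p3 p4 p5 p6)ᶜ 4 v := by
  obtain ⟨i, j, l, m, hi, hj, hl, hm, hij, hlm, hil, him, hjl, hjm⟩ := hd
  let v : Fin 4 → Vertex p1 p2 p3 p4 p5 p6 :=
    ![⟨(Letter.a, i), by simp only [inRange]; omega⟩,
      ⟨(Letter.c, l), by simp only [inRange]; omega⟩,
      ⟨(Letter.b, j), by simp only [inRange]; omega⟩,
      ⟨(Letter.d, m), by simp only [inRange]; omega⟩]
  have hinj : Function.Injective v := by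
    refine Function.Injective.of_comp (f := fun u => u.val.1) ?_
    intro s t hst
    fin_cases s <;> fin_cases t <;> simp_all [v]
  refine ⟨v, hinj, fun s t => ?_⟩
  rw [SimpleGraph.compl_adj, hinj.ne_iff]
  fin_cases s <;> fin_cases t <;> simp [v, tetraGraph, dirAdj] <;> omega

end Cycles

/-- Corollary 3.6 (graph form): chordality of `Ḡ(p)`, i.e. the absence of induced
`r`-cycles for `r ≥ 4`, is equivalent to the non-existence of a decomposition. -/
theorem chordal_iff_no_decomposition (p1 p2 p3 p4 p5 p6 : ℕ)
    (h : max (p2 + p5) (p3 + p4) ≤ p1 + p6) :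
    (∀ r : ℕ, 4 ≤ r → ¬ ∃ v : Fin r → Vertex p1 p2 p3 p4 p5 p6,
      IsInducedCycle (tetraGraph p1 p2 p3 p4 p5 p6)ᶜ r v) ↔
    ¬ AdmitsDecomposition p1 p2 p3 p4 p5 p6 :=
  ⟨fun hchordal hd => hchordal 4 le_rfl hd.exists_isInducedCycle,
    fun hd _ hr ⟨_, hv⟩ => hd (.of_isInducedCycle h hr hv)⟩
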